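/- arXiv:1805.06978 — 4 statements merged into one kernel-verified Lean document; each statement's English description precedes it below -/
import Mathlib

section
/- Let n ≥ 3 and let A0 ⊆ V ∖ {0} be a nonempty connected open conic salient subset, Ā0 its closure in V ∖ {0}, and C0 := Ā0 ∖ A0. Let Ω0 : V → ℝ be a nonzero linear form, Π0 := ker Ω0, and Π := Ω0⁻¹(1) (an affine hyperplane not containing 0). Then the following are equivalent: (i) Ω0(v) > 0 for every v ∈ Ā0 (equivalently, every radial half-line {λv : λ > 0} with v ∈ Ā0 meets Π, necessarily transversely, in exactly one point); (ii) Ω0(v) > 0 for every v ∈ C0; (iii) Π0 ∩ C0 = ∅ and Π ∩ Ā0 ≠ ∅; (iv) Π0 ∩ Ā0 = ∅ and Π ∩ Ā0 ≠ ∅. Moreover, when these equivalent conditions hold, the set Π ∩ Ā0 is compact. -/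
open Set Module

noncomputable section

variable {V : Type*} [NormedAddCommGroup V] [NormedSpace ℝ V]

/-- A subset of `V` is conic if stable under multiplication by positive scalars. -/
def Conic (s : Set V) : Prop := ∀ v ∈ s, ∀ c : ℝ, 0 < c → c • v ∈ s

/-- Salient: contains no pair of opposite vectors. -/
def Salient (s : Set V) : Prop := ∀ v ∈ s, -v ∉ s

theorem Conic.conic_closure {s : Set V} (hs : Conic s) : Conic (closure s) := fun _ hv c hc ↦
  map_mem_closure (continuous_const_smul c) hv fun w hw ↦ hs w hw c hc

/-- The punctured hyperplane `ker Ω \ {0}` is preconnected when `V` has dimension at least `3`. -/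
theorem isPreconnected_ker_diff_zero [FiniteDimensional ℝ V] (hn : 3 ≤ finrank ℝ V)
    (Ω : V →ₗ[ℝ] ℝ) : IsPreconnected ((LinearMap.ker Ω : Set V) \ {0}) := by
  have hrank : 1 < Module.rank ℝ (LinearMap.ker Ω) := by
    rw [← finrank_eq_rank]
    have h₁ := Ω.finrank_range_add_finrank_ker
    have h₂ : finrank ℝ (LinearMap.range Ω) ≤ 1 := by
      simpa using Submodule.finrank_le (LinearMap.range Ω)
    have h₃ : 1 < finrank ℝ (LinearMap.ker Ω) := by omega
    exact_mod_cast h₃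
  have h := (isConnected_compl_singleton_of_one_lt_rank hrank 0).isPreconnected.image
    (Subtype.val : LinearMap.ker Ω → V) continuous_subtype_val.continuousOn
  convert h using 1
  ext v
  simp [and_comm]

/-- An open salient set which meets a preconnected symmetric set avoiding the origin has a
frontier point in it. -/
theorem Salient.exists_mem_frontier {s t : Set V} (hs : Salient s) (ho : IsOpen s)
    (ht : IsPreconnected t) (hneg : ∀ v ∈ t, -v ∈ t) (hst : (t ∩ s).Nonempty) :
    ∃ v ∈ t, v ∈ closure s \ s := by
  by_contra! h
  have hsub : t ⊆ s := ht.subset_of_closure_inter_subset ho hst fun v hv ↦ by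
    by_contra hvs
    exact h v hv.2 ⟨hv.1, hvs⟩
  obtain ⟨v, hvt, hvs⟩ := hst
  exact hs v hvs (hsub (hneg v hvt))

/-- A linear form without zeros on the nonzero frontier points of an open salient set has no
zeros on the nonzero points of its closure. -/
theorem Salient.ne_zero_of_frontier [FiniteDimensional ℝ V] (hn : 3 ≤ finrank ℝ V)
    {s : Set V} (hs : Salient s) (ho : IsOpen s) (Ω : V →ₗ[ℝ] ℝ)
    (h : ∀ v ∈ (closure s \ {0}) \ s, Ω v ≠ 0) : ∀ v ∈ closure s \ {0}, Ω v ≠ 0 := by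
  intro v hv hΩv
  by_cases hvs : v ∈ s
  · obtain ⟨w, hw, hws⟩ := hs.exists_mem_frontier ho (isPreconnected_ker_diff_zero hn Ω)
      (fun w hw ↦ by simpa using hw) ⟨v, ⟨hΩv, hv.2⟩, hvs⟩
    exact h w ⟨⟨hws.1, hw.2⟩, hws.2⟩ hw.1
  · exact h v ⟨hv, hvs⟩ hΩv

theorem pos_of_ne_zero_of_exists_pos [FiniteDimensional ℝ V] {t : Set V}
    (ht : IsPreconnected t) (Ω : V →ₗ[ℝ] ℝ) (h : ∀ v ∈ t, Ω v ≠ 0)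
    (hpos : ∃ v ∈ t, 0 < Ω v) : ∀ v ∈ t, 0 < Ω v := by
  intro v hv
  obtain ⟨w, hw, hΩw⟩ := hpos
  by_contra! hle
  obtain ⟨u, hu, hΩu⟩ := ht.intermediate_value hv hw
    Ω.continuous_of_finiteDimensional.continuousOn ⟨hle, hΩw.le⟩
  exact h u hu hΩu

/-- The section of a closed cone by an affine hyperplane `Ω = 1` is compact when `Ω` is positive
on the nonzero points of the cone. -/
theorem Conic.isCompact_inter_eq_one [FiniteDimensional ℝ V] {s : Set V} (hs : Conic s)
    (hc : IsClosed s) (Ω : V →ₗ[ℝ] ℝ) (hpos : ∀ v ∈ s \ {0}, 0 < Ω v) :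
    IsCompact ((s \ {0}) ∩ {v : V | Ω v = 1}) := by
  have hcont : Continuous Ω := Ω.continuous_of_finiteDimensional
  have : ProperSpace V := FiniteDimensional.proper ℝ V
  have heq : (s \ {0}) ∩ {v : V | Ω v = 1} = s ∩ {v : V | Ω v = 1} := by
    ext v
    simp only [mem_inter_iff, mem_sdiff, mem_singleton_iff, mem_ofPred_eq]
    refine ⟨fun h ↦ ⟨h.1.1, h.2⟩, fun h ↦ ⟨⟨h.1, ?_⟩, h.2⟩⟩
    rintro rfl
    simp at h
  obtain ⟨m, hm, hmle⟩ : ∃ m > 0, ∀ v ∈ Metric.sphere (0 : V) 1 ∩ s, m ≤ Ω v :=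
    ((isCompact_sphere (0 : V) 1).inter_right hc).exists_forall_le' hcont.continuousOn
      fun v hv ↦ hpos v ⟨hv.2, ne_zero_of_mem_unit_sphere ⟨v, hv.1⟩⟩
  refine Metric.isCompact_of_isClosed_isBounded
    (heq ▸ hc.inter (isClosed_eq hcont continuous_const))
    (isBounded_iff_forall_norm_le.2 ⟨m⁻¹, ?_⟩)
  rintro v ⟨⟨hvs, hv0⟩, hv1⟩
  have hn : 0 < ‖v‖ := norm_pos_iff.2 hv0
  have h := hmle (‖v‖⁻¹ • v)
    ⟨by simp [norm_smul, hn.ne'], hs v hvs _ (inv_pos.2 hn)⟩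
  rw [map_smul, show Ω v = 1 from hv1, smul_eq_mul, mul_one] at h
  exact (le_inv_comm₀ hm hn).1 h

/-- equivalent transversality conditions for an affine hyperplane
`Π = Ω₀⁻¹(1)` with respect to a conic domain, and compactness of `Π ∩ Ā₀`. -/
theorem stmt_15 [FiniteDimensional ℝ V] (hn : 3 ≤ finrank ℝ V)
    (A₀ : Set V) (hNe : A₀.Nonempty) (h0 : (0 : V) ∉ A₀)
    (hop : IsOpen A₀) (hconn : IsConnected A₀) (hconic : Conic A₀)
    (hsal : Salient A₀)
    (Ω₀ : V →ₗ[ℝ] ℝ) (hΩ : Ω₀ ≠ 0) :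
    ([ (∀ v ∈ closure A₀ \ {0}, 0 < Ω₀ v),
       (∀ v ∈ (closure A₀ \ {0}) \ A₀, 0 < Ω₀ v),
       ((∀ v ∈ (closure A₀ \ {0}) \ A₀, Ω₀ v ≠ 0) ∧
         ∃ v ∈ closure A₀ \ {0}, Ω₀ v = 1),
       ((∀ v ∈ closure A₀ \ {0}, Ω₀ v ≠ 0) ∧
         ∃ v ∈ closure A₀ \ {0}, Ω₀ v = 1) ].TFAE) ∧
    ((∀ v ∈ closure A₀ \ {0}, 0 < Ω₀ v) →
      IsCompact ((closure A₀ \ {0}) ∩ {v : V | Ω₀ v = 1})) := by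
  have hsub : A₀ ⊆ closure A₀ \ {0} := fun v hv ↦
    ⟨subset_closure hv, fun h ↦ h0 (mem_singleton_iff.1 h ▸ hv)⟩
  have hpre : IsPreconnected (closure A₀ \ {0}) :=
    hconn.isPreconnected.subset_closure hsub sdiff_subset
  refine ⟨?_, hconic.conic_closure.isCompact_inter_eq_one isClosed_closure Ω₀⟩
  tfae_have 1 → 2 := fun h v hv ↦ h v hv.1
  tfae_have 2 → 1 := by
    intro h
    have hrank : 1 < Module.rank ℝ V := by
      rw [← finrank_eq_rank]
      exact_mod_cast (by omega : 1 < finrank ℝ V)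
    obtain ⟨a, ha⟩ := hNe
    obtain ⟨w, hw0, hw⟩ := hsal.exists_mem_frontier hop
      (isConnected_compl_singleton_of_one_lt_rank hrank (0 : V)).isPreconnected
      (fun v hv ↦ by simpa using hv) ⟨a, (hsub ha).2, ha⟩
    exact pos_of_ne_zero_of_exists_pos hpre Ω₀
      (hsal.ne_zero_of_frontier hn hop Ω₀ fun v hv ↦ (h v hv).ne')
      ⟨w, ⟨hw.1, hw0⟩, h w ⟨⟨hw.1, hw0⟩, hw.2⟩⟩
  tfae_have 1 → 4 := by
    intro h
    obtain ⟨a, ha⟩ := hNe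
    have hpos := h a (hsub ha)
    exact ⟨fun v hv ↦ (h v hv).ne', (Ω₀ a)⁻¹ • a,
      hsub (hconic a ha _ (inv_pos.2 hpos)), by simp [hpos.ne']⟩
  tfae_have 4 → 3 := fun h ↦ ⟨fun v hv ↦ h.1 v hv.1, h.2⟩
  tfae_have 3 → 4 := fun h ↦ ⟨hsal.ne_zero_of_frontier hn hop Ω₀ h.1, h.2⟩
  tfae_have 4 → 1 := by
    rintro ⟨h, v, hv, hv1⟩
    exact pos_of_ne_zero_of_exists_pos hpre Ω₀ h ⟨v, hv, hv1 ▸ one_pos⟩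
  tfae_finish
end
end

section
/- Let A ⊆ V ∖ {0} be a nonempty open conic set, let k ≥ 1, let ε_1, …, ε_k ∈ {−1, +1}, and let L1, …, Lk : A → (0,∞) be smooth (C^∞) positively 2-homogeneous functions. Assume Σ_j ε_j·√(L_j(v)) > 0 for all v ∈ A and set L := (Σ_j ε_j·√L_j)². Then L is a smooth positively 2-homogeneous function on A, and for every v ∈ A and all u, w ∈ V its fundamental tensor satisfies g_v(u,w) = Σ_j ε_j·(√L(v)/√(L_j(v)))·h^j_v(u,w) + Σ_{j,l} (ε_j·ε_l/(√(L_j(v))·√(L_l(v))))·g^j_v(v,u)·g^l_v(v,w), and its angular metric satisfies h_v(u,w) = Σ_j ε_j·(√L(v)/√(L_j(v)))·h^j_v(u,w); here g^j is the fundamental tensor of L_j, h^j_v(u,w) := g^j_v(u,w) − g^j_v(v,u)·g^j_v(v,w)/L_j(v) its angular metric, and h_v(u,w) := g_v(u,w) − g_v(v,u)·g_v(v,w)/L(v). -/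
open Set Module Real

noncomputable section

variable {V : Type*} [NormedAddCommGroup V] [NormedSpace ℝ V]

/-- Positively 2-homogeneous on a set. -/
def PosHom2 (L : V → ℝ) (s : Set V) : Prop :=
  ∀ v ∈ s, ∀ c : ℝ, 0 < c → L (c • v) = c ^ 2 * L v

/-- The fundamental tensor of `L` at `v`: `g_v(u,w) = (1/2) D²L(v)(u,w)`. -/
def fundTensor (L : V → ℝ) (v u w : V) : ℝ :=
  (1 / 2 : ℝ) * fderiv ℝ (fderiv ℝ L) v u w

/-- The angular metric of `L` at `v`. -/
def angularMetric (L : V → ℝ) (v u w : V) : ℝ :=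
  fundTensor L v u w - fundTensor L v v u * fundTensor L v v w / L v

/-- The Euler identity for positively 1-homogeneous functions. -/
lemma fderiv_apply_self_of_posHom1 {F : V → ℝ} {v : V} (hF : DifferentiableAt ℝ F v)
    (hh : ∀ c : ℝ, 0 < c → F (c • v) = c * F v) : fderiv ℝ F v v = F v := by
  have hray : HasDerivAt (fun c : ℝ => c • v) v 1 := by
    simpa using (hasDerivAt_id (1 : ℝ)).smul_const v
  have hF' : HasFDerivAt F (fderiv ℝ F v) ((1 : ℝ) • v) := by
    simpa using hF.hasFDerivAt
  have h1 : HasDerivAt (fun c : ℝ => F (c • v)) (fderiv ℝ F v v) 1 :=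
    hF'.comp_hasDerivAt (1 : ℝ) hray
  have h2 : HasDerivAt (fun c : ℝ => c * F v) (F v) 1 := by
    simpa using (hasDerivAt_id (1 : ℝ)).mul_const (F v)
  refine h1.unique (h2.congr_of_eventuallyEq ?_)
  filter_upwards [lt_mem_nhds (zero_lt_one' ℝ)] with c hc using hh c hc

/-- The Hessian of a positively 1-homogeneous function annihilates the radial direction. -/
lemma fderiv_fderiv_apply_self_of_posHom1 {A : Set V} (hop : IsOpen A) {F : V → ℝ}
    (hF : ContDiffOn ℝ (⊤ : ℕ∞) F A) (hh : ∀ v ∈ A, ∀ c : ℝ, 0 < c → F (c • v) = c * F v)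
    {v : V} (hv : v ∈ A) (u : V) : fderiv ℝ (fderiv ℝ F) v v u = 0 := by
  have hA : A ∈ nhds v := hop.mem_nhds hv
  have hFv : ContDiffAt ℝ (⊤ : ℕ∞) F v := hF.contDiffAt hA
  have hsymm : IsSymmSndFDerivAt ℝ F v :=
    hFv.isSymmSndFDerivAt (by
      rw [minSmoothness_of_isRCLikeNormedField]
      exact WithTop.coe_le_coe.2 le_top)
  have hd : DifferentiableAt ℝ (fderiv ℝ F) v :=
    (hFv.fderiv_right (m := 1) (WithTop.coe_le_coe.2 le_top)).differentiableAt one_ne_zero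
  have h1 := hd.hasFDerivAt.clm_apply (hasFDerivAt_id v)
  have h2 : HasFDerivAt (fun y => fderiv ℝ F y (id y)) (fderiv ℝ F v) v := by
    refine (hFv.differentiableAt (by simp)).hasFDerivAt.congr_of_eventuallyEq ?_
    filter_upwards [hA] with y hy
    exact fderiv_apply_self_of_posHom1
      ((hF.contDiffAt (hop.mem_nhds hy)).differentiableAt (by simp)) (hh y hy)
  have h3 := congrArg (fun T : V →L[ℝ] ℝ => T u) (h1.unique h2)
  rw [hsymm.eq v u]
  simpa using h3

/-- The fundamental tensor of a square. -/
lemma fundTensor_of_eq_sq {A : Set V} (hop : IsOpen A) {F L : V → ℝ}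
    (hF : ContDiffOn ℝ (⊤ : ℕ∞) F A) (hL : ∀ v ∈ A, L v = F v ^ 2)
    {v : V} (hv : v ∈ A) (u w : V) :
    fundTensor L v u w =
      F v * fderiv ℝ (fderiv ℝ F) v u w + fderiv ℝ F v u * fderiv ℝ F v w := by
  have hA : A ∈ nhds v := hop.mem_nhds hv
  have hFv : ContDiffAt ℝ (⊤ : ℕ∞) F v := hF.contDiffAt hA
  have hd : DifferentiableAt ℝ (fderiv ℝ F) v :=
    (hFv.fderiv_right (m := 1) (WithTop.coe_le_coe.2 le_top)).differentiableAt one_ne_zero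
  have hD : fderiv ℝ L =ᶠ[nhds v] fun y => (2 * F y) • fderiv ℝ F y := by
    filter_upwards [hA] with y hy
    have hy' := hop.mem_nhds hy
    have hFy := ((hF.contDiffAt hy').differentiableAt (by simp)).hasFDerivAt
    have hLy : L =ᶠ[nhds y] fun z => F z * F z := by
      filter_upwards [hy'] with z hz
      rw [hL z hz, sq]
    rw [hLy.fderiv_eq, (hFy.fun_mul hFy).fderiv, ← add_smul, two_mul]
  have hFd := (hFv.differentiableAt (by simp)).hasFDerivAt
  have h1 := ((hFd.const_mul 2).fun_smul hd.hasFDerivAt).fderiv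
  rw [fundTensor, hD.fderiv_eq, h1]
  simp
  ring

lemma fundTensor_self_of_eq_sq {A : Set V} (hop : IsOpen A) {F L : V → ℝ}
    (hF : ContDiffOn ℝ (⊤ : ℕ∞) F A) (hh : ∀ v ∈ A, ∀ c : ℝ, 0 < c → F (c • v) = c * F v)
    (hL : ∀ v ∈ A, L v = F v ^ 2) {v : V} (hv : v ∈ A) (u : V) :
    fundTensor L v v u = F v * fderiv ℝ F v u := by
  rw [fundTensor_of_eq_sq hop hF hL hv, fderiv_fderiv_apply_self_of_posHom1 hop hF hh hv,
    fderiv_apply_self_of_posHom1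
      ((hF.contDiffAt (hop.mem_nhds hv)).differentiableAt (by simp)) (hh v hv)]
  ring

/-- The angular metric of the square of a 1-homogeneous function `F` is `F` times its Hessian. -/
lemma angularMetric_of_eq_sq {A : Set V} (hop : IsOpen A) {F L : V → ℝ}
    (hF : ContDiffOn ℝ (⊤ : ℕ∞) F A) (hh : ∀ v ∈ A, ∀ c : ℝ, 0 < c → F (c • v) = c * F v)
    (hL : ∀ v ∈ A, L v = F v ^ 2) {v : V} (hv : v ∈ A) (hpos : 0 < F v) (u w : V) :
    angularMetric L v u w = F v * fderiv ℝ (fderiv ℝ F) v u w := by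
  rw [angularMetric, fundTensor_self_of_eq_sq hop hF hh hL hv,
    fundTensor_self_of_eq_sq hop hF hh hL hv, fundTensor_of_eq_sq hop hF hL hv, hL v hv]
  field_simp
  ring

lemma fderiv_sum_const_mul {ι : Type*} [Fintype ι] {A : Set V} (hop : IsOpen A)
    (ε : ι → ℝ) {F : ι → V → ℝ} (hF : ∀ j, ContDiffOn ℝ (⊤ : ℕ∞) (F j) A)
    {v : V} (hv : v ∈ A) :
    fderiv ℝ (fun y => ∑ j, ε j * F j y) v = ∑ j, ε j • fderiv ℝ (F j) v := by
  refine (HasFDerivAt.fun_sum fun j _ => HasFDerivAt.const_mul ?_ (ε j)).fderiv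
  exact (((hF j).contDiffAt (hop.mem_nhds hv)).differentiableAt (by simp)).hasFDerivAt

lemma fderiv_fderiv_sum_const_mul {ι : Type*} [Fintype ι] {A : Set V} (hop : IsOpen A)
    (ε : ι → ℝ) {F : ι → V → ℝ} (hF : ∀ j, ContDiffOn ℝ (⊤ : ℕ∞) (F j) A)
    {v : V} (hv : v ∈ A) :
    fderiv ℝ (fderiv ℝ (fun y => ∑ j, ε j * F j y)) v =
      ∑ j, ε j • fderiv ℝ (fderiv ℝ (F j)) v := by
  have hA : A ∈ nhds v := hop.mem_nhds hv
  have h : fderiv ℝ (fun y => ∑ j, ε j * F j y) =ᶠ[nhds v]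
      fun y => ∑ j, ε j • fderiv ℝ (F j) y := by
    filter_upwards [hA] with y hy using fderiv_sum_const_mul hop ε hF hy
  rw [h.fderiv_eq]
  refine (HasFDerivAt.fun_sum fun j _ => HasFDerivAt.fun_const_smul ?_ (ε j)).fderiv
  exact ((((hF j).contDiffAt hA).fderiv_right (m := 1)
    (WithTop.coe_le_coe.2 le_top)).differentiableAt one_ne_zero).hasFDerivAt

/-- fundamental tensor and angular metric of
`L = (∑ⱼ εⱼ √Lⱼ)²`. -/
theorem stmt_17 [FiniteDimensional ℝ V] (hn : 2 ≤ finrank ℝ V)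
    (A : Set V) (hNe : A.Nonempty) (hop : IsOpen A) (hconic : Conic A)
    (h0 : (0 : V) ∉ A)
    (k : ℕ) (hk : 1 ≤ k) (ε : Fin k → ℝ) (hε : ∀ j, ε j = 1 ∨ ε j = -1)
    (Lf : Fin k → V → ℝ)
    (hpos : ∀ j, ∀ v ∈ A, 0 < Lf j v)
    (hsmooth : ∀ j, ContDiffOn ℝ (⊤ : ℕ∞) (Lf j) A)
    (hhom : ∀ j, PosHom2 (Lf j) A)
    (hsumpos : ∀ v ∈ A, 0 < ∑ j : Fin k, ε j * Real.sqrt (Lf j v))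
    (L : V → ℝ) (hLdef : ∀ v, L v = (∑ j : Fin k, ε j * Real.sqrt (Lf j v)) ^ 2) :
    ContDiffOn ℝ (⊤ : ℕ∞) L A ∧ PosHom2 L A ∧
    (∀ v ∈ A, ∀ u w : V,
      fundTensor L v u w =
        (∑ j : Fin k, ε j * (Real.sqrt (L v) / Real.sqrt (Lf j v)) *
            angularMetric (Lf j) v u w) +
        (∑ j : Fin k, ∑ l : Fin k,
            (ε j * ε l / (Real.sqrt (Lf j v) * Real.sqrt (Lf l v))) *
              fundTensor (Lf j) v v u * fundTensor (Lf l) v v w)) ∧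
    (∀ v ∈ A, ∀ u w : V,
      angularMetric L v u w =
        ∑ j : Fin k, ε j * (Real.sqrt (L v) / Real.sqrt (Lf j v)) *
          angularMetric (Lf j) v u w) := by
  set F : Fin k → V → ℝ := fun j v => √(Lf j v) with hFdef
  set S : V → ℝ := fun v => ∑ j, ε j * F j v with hSdef
  have hF : ∀ j, ContDiffOn ℝ (⊤ : ℕ∞) (F j) A := fun j =>
    (hsmooth j).sqrt fun v hv => (hpos j v hv).ne'
  have hFpos : ∀ j, ∀ v ∈ A, 0 < F j v := fun j v hv => Real.sqrt_pos.2 (hpos j v hv)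
  have hFhom : ∀ j, ∀ v ∈ A, ∀ c : ℝ, 0 < c → F j (c • v) = c * F j v := by
    intro j v hv c hc
    simp only [hFdef]
    rw [hhom j v hv c hc, Real.sqrt_mul (sq_nonneg c), Real.sqrt_sq hc.le]
  have hFsq : ∀ j, ∀ v ∈ A, Lf j v = F j v ^ 2 := fun j v hv =>
    (Real.sq_sqrt (hpos j v hv).le).symm
  have hS : ContDiffOn ℝ (⊤ : ℕ∞) S A :=
    ContDiffOn.sum fun j _ => contDiffOn_const.mul (hF j)
  have hShom : ∀ v ∈ A, ∀ c : ℝ, 0 < c → S (c • v) = c * S v := by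
    intro v hv c hc
    simp only [hSdef, Finset.mul_sum]
    refine Finset.sum_congr rfl fun j _ => ?_
    rw [hFhom j v hv c hc]
    ring
  have hSpos : ∀ v ∈ A, 0 < S v := hsumpos
  have hLS : ∀ v ∈ A, L v = S v ^ 2 := fun v _ => hLdef v
  have hang : ∀ v ∈ A, ∀ u w : V, ∑ j : Fin k, ε j * (√(L v) / √(Lf j v)) *
      angularMetric (Lf j) v u w = S v * fderiv ℝ (fderiv ℝ S) v u w := by
    intro v hv u w
    rw [fderiv_fderiv_sum_const_mul hop ε hF hv, hLS v hv, Real.sqrt_sq (hSpos v hv).le]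
    simp only [_root_.sum_apply, _root_.smul_apply, smul_eq_mul]
    rw [Finset.mul_sum]
    refine Finset.sum_congr rfl fun j _ => ?_
    rw [angularMetric_of_eq_sq hop (hF j) (hFhom j) (hFsq j) hv (hFpos j v hv)]
    change ε j * (S v / F j v) * _ = _
    have := (hFpos j v hv).ne'
    field_simp
  refine ⟨(hS.pow 2).congr hLS, ?_, ?_, ?_⟩
  · intro v hv c hc
    rw [hLS _ (hconic v hv c hc), hLS v hv, hShom v hv c hc, mul_pow]
  · intro v hv u w
    rw [hang v hv, fundTensor_of_eq_sq hop hS hLS hv, fderiv_sum_const_mul hop ε hF hv]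
    simp only [_root_.sum_apply, _root_.smul_apply, smul_eq_mul]
    rw [Finset.sum_mul_sum]
    congr 1
    refine Finset.sum_congr rfl fun j _ => Finset.sum_congr rfl fun l _ => ?_
    rw [fundTensor_self_of_eq_sq hop (hF j) (hFhom j) (hFsq j) hv,
      fundTensor_self_of_eq_sq hop (hF l) (hFhom l) (hFsq l) hv]
    change _ = ε j * ε l / (F j v * F l v) * _ * _
    have := (hFpos j v hv).ne'
    have := (hFpos l v hv).ne'
    field_simp
  · intro v hv u w
    rw [hang v hv, angularMetric_of_eq_sq hop hS hShom hLS hv (hSpos v hv)]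
end
end

section
/- Let A ⊆ V ∖ {0} be a nonempty open conic set and let L1, L2 : A → (0,∞) be smooth (C^∞) positively 2-homogeneous functions whose fundamental tensors g¹_v and g²_v are nondegenerate with index n−1 at every v ∈ A. Then the function L := √(L1·L2) is a smooth positively 2-homogeneous function on A whose fundamental tensor is nondegenerate with index n−1 at every v ∈ A. -/
open Set Module

noncomputable section

variable {V : Type*} [NormedAddCommGroup V] [NormedSpace ℝ V]

/-- Lorentzian: nondegenerate and negative definite on a subspace of dimension `n-1`. -/
def IsLorentzForm (g : V → V → ℝ) : Prop :=
  (∀ u : V, (∀ w : V, g u w = 0) → u = 0) ∧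
  ∃ W : Submodule ℝ V, finrank ℝ W = finrank ℝ V - 1 ∧
    ∀ u ∈ W, u ≠ 0 → g u u < 0

/-- The strict reversed Cauchy–Schwarz inequality: for a symmetric form that is negative definite on
a hyperplane and positive at `v`, it holds for every vector outside the line through `v`. -/
theorem reversed_cauchy_schwarz [FiniteDimensional ℝ V] (B : V →L[ℝ] V →L[ℝ] ℝ)
    (hsymm : ∀ x y, B x y = B y x) (W : Submodule ℝ V) (hW : finrank ℝ W = finrank ℝ V - 1)
    (hneg : ∀ x ∈ W, x ≠ 0 → B x x < 0) {v u : V} (hv : 0 < B v v)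
    (hu : ∀ c : ℝ, u ≠ c • v) : B u u * B v v < B v u ^ 2 := by
  have hv0 : v ≠ 0 := by
    rintro rfl
    simp at hv
  have hli : LinearIndependent ℝ ![v, u] :=
    (LinearIndependent.pair_iff' hv0).2 fun c h => hu c h.symm
  obtain ⟨x, hxW, hxS, hx0⟩ : ∃ x ∈ W, x ∈ Submodule.span ℝ {v, u} ∧ x ≠ 0 := by
    by_contra! h
    have hdisj : Disjoint W (Submodule.span ℝ {v, u}) :=
      Submodule.disjoint_def.2 h
    have hle := Submodule.finrank_add_finrank_le_of_disjoint hdisj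
    have hS : finrank ℝ (Submodule.span ℝ {v, u}) = 2 := by
      rw [← Matrix.range_cons_cons_empty v u ![], finrank_span_eq_card hli, Fintype.card_fin]
    have : 0 < finrank ℝ V := Module.finrank_pos_iff_exists_ne_zero.2 ⟨v, hv0⟩
    omega
  obtain ⟨a, b, rfl⟩ := Submodule.mem_span_pair.1 hxS
  have h := hneg _ hxW hx0
  simp only [map_add, map_smul, add_apply, smul_apply, smul_eq_mul, hsymm u v] at h
  have hsq : 0 ≤ (a * B v v + b * B v u) ^ 2 := sq_nonneg _
  have hlt : b ^ 2 * (B u u * B v v - B v u ^ 2) < 0 := by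
    nlinarith [mul_neg_of_neg_of_pos h hv]
  have := neg_of_mul_neg_right hlt (sq_nonneg b)
  linarith

theorem fderiv_apply_self_of_posHom2 {L : V → ℝ} {A : Set V} (hhom : PosHom2 L A) {v : V}
    (hv : v ∈ A) (hd : DifferentiableAt ℝ L v) : fderiv ℝ L v v = 2 * L v := by
  have hray : HasDerivAt (fun c : ℝ => c • v) v 1 := by
    simpa using (hasDerivAt_id (1 : ℝ)).smul_const v
  have h1 : HasDerivAt (fun c : ℝ => L (c • v)) (fderiv ℝ L v v) 1 := by
    have hd' : HasFDerivAt L (fderiv ℝ L v) ((1 : ℝ) • v) := by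
      simpa using hd.hasFDerivAt
    exact hd'.comp_hasDerivAt (1 : ℝ) hray
  have h2 : HasDerivAt (fun c : ℝ => c ^ 2 * L v) (2 * L v) 1 := by
    simpa using (hasDerivAt_pow 2 (1 : ℝ)).mul_const (L v)
  refine h1.unique (h2.congr_of_eventuallyEq ?_)
  filter_upwards [lt_mem_nhds (zero_lt_one' ℝ)] with c hc using hhom v hv c hc

theorem fderiv_fderiv_apply_self_of_posHom2 {L : V → ℝ} {A : Set V} (hop : IsOpen A)
    (hhom : PosHom2 L A) (hL : ContDiffOn ℝ 2 L A) {v : V} (hv : v ∈ A) (w : V) :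
    fderiv ℝ (fderiv ℝ L) v w v = fderiv ℝ L v w := by
  have hd : ∀ x ∈ A, DifferentiableAt ℝ L x := fun x hx =>
    (hL.contDiffAt (hop.mem_nhds hx)).differentiableAt (by norm_num)
  have hd2 : DifferentiableAt ℝ (fderiv ℝ L) v :=
    ((hL.contDiffAt (hop.mem_nhds hv)).fderiv_right (m := 1) (by norm_num)).differentiableAt
      (by norm_num)
  have h1 := hd2.hasFDerivAt.clm_apply (hasFDerivAt_id v)
  have h2 := (hd v hv).hasFDerivAt.const_mul 2
  have h := h1.unique (h2.congr_of_eventuallyEq (by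
    filter_upwards [hop.mem_nhds hv] with x hx
    exact fderiv_apply_self_of_posHom2 hhom hx (hd x hx)))
  have := congrArg (fun T : V →L[ℝ] ℝ => T w) h
  simp at this
  linarith

theorem fderiv_fderiv_mul_apply_self {f g : V → ℝ} {v : V} (hf : ContDiffAt ℝ 2 f v)
    (hg : ContDiffAt ℝ 2 g v) (u : V) :
    fderiv ℝ (fderiv ℝ fun x => f x * g x) v u u =
      f v * fderiv ℝ (fderiv ℝ g) v u u + g v * fderiv ℝ (fderiv ℝ f) v u u
        + 2 * (fderiv ℝ f v u * fderiv ℝ g v u) := by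
  have hd2 : ∀ {h : V → ℝ}, ContDiffAt ℝ 2 h v →
      HasFDerivAt (fderiv ℝ h) (fderiv ℝ (fderiv ℝ h) v) v := fun hh =>
    ((hh.fderiv_right (m := 1) (by norm_num)).differentiableAt (by norm_num)).hasFDerivAt
  have hd : ∀ {h : V → ℝ}, ContDiffAt ℝ 2 h v → HasFDerivAt h (fderiv ℝ h v) v := fun hh =>
    (hh.differentiableAt (by norm_num)).hasFDerivAt
  have hev : (fderiv ℝ fun x => f x * g x) =ᶠ[nhds v]
      fun x => f x • fderiv ℝ g x + g x • fderiv ℝ f x := by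
    filter_upwards [hf.eventually (by norm_num), hg.eventually (by norm_num)] with x hfx hgx
    exact fderiv_fun_mul (hfx.differentiableAt (by norm_num)) (hgx.differentiableAt (by norm_num))
  have h := (((hd hf).smul (hd2 hg)).add ((hd hg).smul (hd2 hf))).congr_of_eventuallyEq hev
  rw [h.fderiv]
  simp
  ring

/-- A positively 2-homogeneous function whose Hessian is negative definite on the kernel of its
differential has Lorentzian fundamental tensor. -/
theorem isLorentzForm_fundTensor_of_neg_on_ker [FiniteDimensional ℝ V] {L : V → ℝ} {v : V}
    (heuler : ∀ w, fderiv ℝ (fderiv ℝ L) v w v = fderiv ℝ L v w) (hne : fderiv ℝ L v ≠ 0)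
    (hneg : ∀ u, fderiv ℝ L v u = 0 → u ≠ 0 → fderiv ℝ (fderiv ℝ L) v u u < 0) :
    IsLorentzForm (fundTensor L v) := by
  constructor
  · intro u hu
    by_contra hu0
    have h1 := hu v
    have h2 := hu u
    simp only [fundTensor, heuler] at h1 h2
    linarith [hneg u (by linarith) hu0]
  · refine ⟨LinearMap.ker (fderiv ℝ L v : V →ₗ[ℝ] ℝ), ?_, fun u hu hu0 => ?_⟩
    · have h1 := Module.Dual.finrank_ker_add_one_of_ne_zero 
        (f := (fderiv ℝ L v : V →ₗ[ℝ] ℝ)) fun h => hne (ContinuousLinearMap.coe_injective h)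
      omega
    · have := hneg u hu hu0
      simp only [fundTensor]
      linarith

/-- The Hessian of a Lorentzian positively 2-homogeneous function is bounded above, strictly
outside the radial direction, by a multiple of the square of the differential. -/
theorem fderiv_fderiv_lt_of_isLorentzForm [FiniteDimensional ℝ V] {L : V → ℝ} {A : Set V}
    (hop : IsOpen A) (hhom : PosHom2 L A) (hL : ContDiffOn ℝ 2 L A) {v : V} (hv : v ∈ A)
    (hpos : 0 < L v) (hLor : IsLorentzForm (fundTensor L v)) {u : V}
    (hu : ∀ c : ℝ, u ≠ c • v) :
    fderiv ℝ (fderiv ℝ L) v u u * (2 * L v) < fderiv ℝ L v u ^ 2 := by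
  obtain ⟨-, W, hW, hneg⟩ := hLor
  have hCD := hL.contDiffAt (hop.mem_nhds hv)
  have hsymm : IsSymmSndFDerivAt ℝ L v := hCD.isSymmSndFDerivAt (by simp)
  have heuler := fderiv_fderiv_apply_self_of_posHom2 hop hhom hL hv
  have hvv : fderiv ℝ (fderiv ℝ L) v v v = 2 * L v :=
    (heuler v).trans (fderiv_apply_self_of_posHom2 hhom hv (hCD.differentiableAt (by norm_num)))
  have h := reversed_cauchy_schwarz (fderiv ℝ (fderiv ℝ L) v) hsymm W hW
    (fun x hx hx0 => by have := hneg x hx hx0; simp only [fundTensor] at this; linarith)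
    (by rw [hvv]; positivity) hu
  rwa [hvv, hsymm v u, heuler u] at h

/-- the geometric mean `√(L1·L2)` of two Lorentz-Finsler Lagrangians
with the same domain is again a Lorentz-Finsler Lagrangian there. -/
theorem stmt_18 [FiniteDimensional ℝ V] (hn : 2 ≤ finrank ℝ V)
    (A : Set V) (hNe : A.Nonempty) (hop : IsOpen A) (hconic : Conic A)
    (h0 : (0 : V) ∉ A)
    (L1 L2 : V → ℝ)
    (hpos1 : ∀ v ∈ A, 0 < L1 v) (hpos2 : ∀ v ∈ A, 0 < L2 v)
    (hsmooth1 : ContDiffOn ℝ (⊤ : ℕ∞) L1 A) (hsmooth2 : ContDiffOn ℝ (⊤ : ℕ∞) L2 A)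
    (hhom1 : PosHom2 L1 A) (hhom2 : PosHom2 L2 A)
    (hLor1 : ∀ v ∈ A, IsLorentzForm (fundTensor L1 v))
    (hLor2 : ∀ v ∈ A, IsLorentzForm (fundTensor L2 v))
    (L : V → ℝ) (hLdef : ∀ v, L v = Real.sqrt (L1 v * L2 v)) :
    ContDiffOn ℝ (⊤ : ℕ∞) L A ∧ PosHom2 L A ∧
    ∀ v ∈ A, IsLorentzForm (fundTensor L v) := by
  have hposm : ∀ v ∈ A, 0 < L1 v * L2 v := fun v hv => mul_pos (hpos1 v hv) (hpos2 v hv)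
  have hLfun : L = fun v => Real.sqrt (L1 v * L2 v) := funext hLdef
  have hsmooth : ContDiffOn ℝ (⊤ : ℕ∞) L A := by
    rw [hLfun]
    exact (hsmooth1.mul hsmooth2).sqrt fun v hv => (hposm v hv).ne'
  have hhom : PosHom2 L A := by
    intro v hv c hc
    rw [hLdef, hLdef, hhom1 v hv c hc, hhom2 v hv c hc,
      show c ^ 2 * L1 v * (c ^ 2 * L2 v) = (c ^ 2) ^ 2 * (L1 v * L2 v) by ring,
      Real.sqrt_mul (by positivity), Real.sqrt_sq (by positivity)]
  refine ⟨hsmooth, hhom, fun v hv => ?_⟩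
  have hle : (2 : WithTop ℕ∞) ≤ ((⊤ : ℕ∞) : WithTop ℕ∞) := 
    WithTop.coe_le_coe.2 (le_top : (2 : ℕ∞) ≤ ⊤)
  have hA := hop.mem_nhds hv
  have hC := (hsmooth.of_le hle).contDiffAt hA
  have hC1 := (hsmooth1.of_le hle).contDiffAt hA
  have hC2 := (hsmooth2.of_le hle).contDiffAt hA
  have hp1 := hpos1 v hv
  have hp2 := hpos2 v hv
  have hp : 0 < L v := by
    rw [hLdef]
    exact Real.sqrt_pos.2 (hposm v hv)
  have hvv : fderiv ℝ L v v = 2 * L v :=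
    fderiv_apply_self_of_posHom2 hhom hv (hC.differentiableAt (by norm_num))
  have hsq : (fun x => L x * L x) =ᶠ[nhds v] fun x => L1 x * L2 x := by
    filter_upwards [hA] with x hx
    rw [hLdef, Real.mul_self_sqrt (hposm x hx).le]
  refine isLorentzForm_fundTensor_of_neg_on_ker
    (fderiv_fderiv_apply_self_of_posHom2 hop hhom (hsmooth.of_le hle) hv) ?_ fun u hu hu0 => ?_
  · intro h
    simp only [h, zero_apply] at hvv
    linarith
  have hu' : ∀ c : ℝ, u ≠ c • v := by
    rintro c rfl
    rw [map_smul, hvv, smul_eq_mul] at hu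
    have hc : c = 0 := (mul_eq_zero.1 hu).resolve_right (by positivity)
    exact hu0 (by simp [hc])
  have hlt1 := fderiv_fderiv_lt_of_isLorentzForm hop hhom1 (hsmooth1.of_le hle) hv hp1
    (hLor1 v hv) hu'
  have hlt2 := fderiv_fderiv_lt_of_isLorentzForm hop hhom2 (hsmooth2.of_le hle) hv hp2
    (hLor2 v hv) hu'
  have hd := congrArg (fun T : V →L[ℝ] ℝ => T u) hsq.fderiv_eq
  have hdd := congrArg (fun T : V →L[ℝ] V →L[ℝ] ℝ => T u u) hsq.fderiv.fderiv_eq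
  have hD : DifferentiableAt ℝ L v := hC.differentiableAt (by norm_num)
  simp only [fderiv_fun_mul hD hD, fderiv_fun_mul (hC1.differentiableAt (by norm_num))
    (hC2.differentiableAt (by norm_num)), add_apply,
    smul_apply, smul_eq_mul, hu] at hd
  simp only [fderiv_fderiv_mul_apply_self hC hC, fderiv_fderiv_mul_apply_self hC1 hC2, hu] at hdd
  generalize fderiv ℝ (fderiv ℝ L) v u u = H at *
  generalize fderiv ℝ (fderiv ℝ L1) v u u = H1 at *
  generalize fderiv ℝ (fderiv ℝ L2) v u u = H2 at *
  obtain ⟨p, hp_def⟩ : ∃ p, fderiv ℝ L1 v u = p * L1 v := ⟨_, (div_mul_cancel₀ _ hp1.ne').symm⟩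
  have hq : fderiv ℝ L2 v u = -p * L2 v := by
    apply mul_left_cancel₀ hp1.ne'
    rw [hp_def] at hd
    linarith
  rw [hp_def] at hlt1 hdd
  rw [hq] at hlt2 hdd
  have h1 : 2 * H1 < p ^ 2 * L1 v := lt_of_mul_lt_mul_right (by linarith) hp1.le
  have h2 : 2 * H2 < p ^ 2 * L2 v := lt_of_mul_lt_mul_right (by linarith) hp2.le
  have h3 := mul_lt_mul_of_pos_left h1 hp2
  have h4 := mul_lt_mul_of_pos_left h2 hp1
  have h5 : 0 ≤ p ^ 2 * (L1 v * L2 v) := by positivity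
  by_contra! hH
  have h6 := mul_nonneg hp.le hH
  nlinarith
end
end

section
/- Let A ⊆ V ∖ {0} be a nonempty open conic set, L0 : A → (0,∞) a smooth (C^∞) positively 2-homogeneous function whose fundamental tensor g⁰_v is nondegenerate with index n−1 at every v ∈ A, and β : V → ℝ a linear form with β(v) > 0 for every v ∈ A. Let b ∈ (−1, 0). Then the Bogoslovsky-type Lagrangian L(v) := L0(v)^{1+b}/β(v)^{2b} is a smooth positively 2-homogeneous function on A whose fundamental tensor is nondegenerate with index n−1 at every v ∈ A. -/
open Set Module Real

noncomputable section

variable {V : Type*} [NormedAddCommGroup V] [NormedSpace ℝ V]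

theorem ContDiffAt.differentiableAt_fderiv_of_two_le {f : V → ℝ} {v : V}
    (hf : ContDiffAt ℝ 2 f v) : DifferentiableAt ℝ (fderiv ℝ f) v :=
  (hf.fderiv_right (m := 1) (by norm_num)).differentiableAt (by norm_num)

/-- Euler's relation for the first derivative of a positively 2-homogeneous function. -/
theorem PosHom2.fderiv_apply_self {f : V → ℝ} {A : Set V} (hf : PosHom2 f A) {v : V}
    (hv : v ∈ A) (hd : DifferentiableAt ℝ f v) : fderiv ℝ f v v = 2 * f v := by
  have h1 : HasDerivAt (fun t : ℝ => f (t • v)) (fderiv ℝ f v v) 1 := by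
    have hl : HasDerivAt (fun t : ℝ => t • v) v 1 := by
      simpa using (hasDerivAt_id (1 : ℝ)).smul_const v
    have hd' : HasFDerivAt f (fderiv ℝ f v) ((1 : ℝ) • v) := by
      simpa using hd.hasFDerivAt
    exact hd'.comp_hasDerivAt 1 hl
  have h2 : HasDerivAt (fun t : ℝ => f (t • v)) (2 * f v) 1 := by
    have h3 : HasDerivAt (fun t : ℝ => t ^ 2 * f v) (2 * f v) 1 := by
      simpa using (hasDerivAt_pow 2 (1 : ℝ)).mul_const (f v)
    refine h3.congr_of_eventuallyEq ?_
    filter_upwards [lt_mem_nhds (zero_lt_one' ℝ)] with t ht using hf v hv t ht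
  exact h1.unique h2

/-- Euler's relation for the second derivative of a positively 2-homogeneous function. -/
theorem PosHom2.fderiv_fderiv_apply_self {f : V → ℝ} {A : Set V} (hf : PosHom2 f A)
    (hA : IsOpen A) (hs : ContDiffOn ℝ 2 f A) {v : V} (hv : v ∈ A) (w : V) :
    fderiv ℝ (fderiv ℝ f) v w v = fderiv ℝ f v w := by
  have hat : ∀ x ∈ A, ContDiffAt ℝ 2 f x := fun x hx => hs.contDiffAt (hA.mem_nhds hx)
  have hd : ∀ x ∈ A, DifferentiableAt ℝ f x := fun x hx =>
    (hat x hx).differentiableAt (by norm_num)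
  have h1 := (hat v hv).differentiableAt_fderiv_of_two_le.hasFDerivAt.clm_apply (hasFDerivAt_id v)
  have h2 : HasFDerivAt (fun x => fderiv ℝ f x (id x)) ((2 : ℝ) • fderiv ℝ f v) v := by
    refine ((hd v hv).hasFDerivAt.const_mul 2).congr_of_eventuallyEq ?_
    filter_upwards [hA.mem_nhds hv] with x hx using hf.fderiv_apply_self hx (hd x hx)
  have h3 := DFunLike.congr_fun (h1.unique h2) w
  simp at h3
  linarith

theorem fderiv_fderiv_log {f : V → ℝ} {v : V} (hf : ContDiffAt ℝ 2 f v) (hv : 0 < f v)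
    (u w : V) :
    fderiv ℝ (fderiv ℝ fun x => Real.log (f x)) v u w =
      fderiv ℝ (fderiv ℝ f) v u w / f v - fderiv ℝ f v u * fderiv ℝ f v w / f v ^ 2 := by
  have hd := hf.differentiableAt (by norm_num)
  have h1 : fderiv ℝ (fun x => Real.log (f x)) =ᶠ[nhds v] fun x => (f x)⁻¹ • fderiv ℝ f x := by
    filter_upwards [hf.eventually (by norm_num), hd.continuousAt.eventually_ne hv.ne']
      with x hx hx0
    exact ((hx.differentiableAt (by norm_num)).hasFDerivAt.log hx0).fderiv
  have h2 : HasFDerivAt (fun x => (f x)⁻¹) _ v :=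
    (hasDerivAt_inv hv.ne').comp_hasFDerivAt v hd.hasFDerivAt
  have h3 : HasFDerivAt (fun x => (f x)⁻¹ • fderiv ℝ f x) _ v :=
    h2.smul hf.differentiableAt_fderiv_of_two_le.hasFDerivAt
  rw [h1.fderiv_eq, h3.fderiv]
  simp
  field_simp
  ring

/-- A symmetric form that is negative definite on a hyperplane and positive at `v` is negative
definite on the orthogonal complement of `v`. -/
theorem neg_of_orthogonal_of_pos [FiniteDimensional ℝ V] (B : V →L[ℝ] V →L[ℝ] ℝ)
    (hsymm : ∀ u w, B u w = B w u) {W : Submodule ℝ V} (hW : finrank ℝ W = finrank ℝ V - 1)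
    (hneg : ∀ u ∈ W, u ≠ 0 → B u u < 0) {v : V} (hv : 0 < B v v) {h : V} (hh : B v h = 0)
    (h0 : h ≠ 0) : B h h < 0 := by
  by_contra! hge
  have hvW : v ∉ W := fun hvW => by
    have : v ≠ 0 := by rintro rfl; simp at hv
    exact (hneg v hvW this).not_gt hv
  have hq : finrank ℝ (V ⧸ W) = 1 := by
    have h1 := W.finrank_quotient_add_finrank
    have : 0 < finrank ℝ V := by
      have : Nontrivial V := ⟨h, 0, h0⟩
      exact finrank_pos
    omega
  obtain ⟨t, ht⟩ := exists_smul_eq_of_finrank_eq_one hq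
    (x := W.mkQ v) (by simpa using hvW) (W.mkQ h)
  have hmem : h - t • v ∈ W := by
    rw [← Submodule.ker_mkQ W, LinearMap.mem_ker, map_sub, map_smul, ht, sub_self]
  have hval : B (h - t • v) (h - t • v) = B h h + t ^ 2 * B v v := by
    simp [hsymm h v, hh]
    ring
  by_cases hz : h - t • v = 0
  · rw [sub_eq_zero.mp hz] at hh h0
    simp only [map_smul, smul_eq_mul, mul_eq_zero, hv.ne', or_false] at hh
    simp [hh] at h0
  · have := hneg _ hmem hz
    nlinarith [mul_nonneg (sq_nonneg t) hv.le]

/-- A symmetric form that is positive at `v` and negative definite on the orthogonal complement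
of `v` is Lorentzian. -/
theorem isLorentzForm_of_neg_orthogonal [FiniteDimensional ℝ V] (B : V →L[ℝ] V →L[ℝ] ℝ)
    (hsymm : ∀ u w, B u w = B w u) {v : V} (hv : 0 < B v v)
    (hneg : ∀ h, B v h = 0 → h ≠ 0 → B h h < 0) : IsLorentzForm fun u w => B u w := by
  refine ⟨fun u hu => ?_, (B v).toLinearMap.ker, ?_, fun u hu => hneg u hu⟩
  · by_contra h0
    exact (hneg u ((hsymm v u).trans (hu v)) h0).ne (hu u)
  · have hr : (B v).toLinearMap.range = ⊤ :=
      LinearMap.range_eq_top.2 (LinearMap.surjective fun h => by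
        have := DFunLike.congr_fun h v
        exact hv.ne' this)
    have h1 := (B v).toLinearMap.finrank_range_add_finrank_ker
    rw [hr, finrank_top, finrank_self] at h1
    omega

/-- The Hessian of the logarithm of a Lorentz-Finsler Lagrangian is negative definite. -/
theorem fderiv_fderiv_log_neg [FiniteDimensional ℝ V] {f : V → ℝ} {A : Set V} (hA : IsOpen A)
    (hs : ContDiffOn ℝ 2 f A) (hf : PosHom2 f A) {v : V} (hv : v ∈ A) (hpos : 0 < f v)
    (hLor : IsLorentzForm (fundTensor f v)) {u : V} (hu : u ≠ 0) :
    fderiv ℝ (fderiv ℝ fun x => Real.log (f x)) v u u < 0 := by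
  have hat : ContDiffAt ℝ 2 f v := hs.contDiffAt (hA.mem_nhds hv)
  rw [fderiv_fderiv_log hat hpos]
  have hsymm : ∀ x y, fderiv ℝ (fderiv ℝ f) v x y = fderiv ℝ (fderiv ℝ f) v y x :=
    fun x y => (hat.isSymmSndFDerivAt (by simp)).eq x y
  have h1 := hf.fderiv_fderiv_apply_self hA hs hv
  have h2 := hf.fderiv_apply_self hv (hat.differentiableAt (by norm_num))
  obtain ⟨-, W, hW, hneg⟩ := hLor
  simp only [fundTensor] at hneg
  set B := fderiv ℝ (fderiv ℝ f) v
  have hvv : B v v = 2 * f v := by rw [h1, h2]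
  set a : ℝ := fderiv ℝ f v u / (2 * f v) with ha
  have hau : fderiv ℝ f v u = 2 * f v * a := by rw [ha]; field_simp
  have hvu : B v u = 2 * f v * a := by rw [hsymm, h1, hau]
  have hdec : B u u = 2 * f v * a ^ 2 + B (u - a • v) (u - a • v) := by
    simp [hsymm u v, hvu, hvv]
    ring
  have hkey : B u u / f v - fderiv ℝ f v u * fderiv ℝ f v u / f v ^ 2 =
      B (u - a • v) (u - a • v) / f v - 2 * a ^ 2 := by
    rw [hdec, hau]
    field_simp
    ring
  rw [hkey]
  by_cases hz : u - a • v = 0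
  · have ha0 : a ≠ 0 := by
      intro h
      simp [h] at hz
      exact hu hz
    have := pow_pos (abs_pos.mpr ha0) 2
    rw [sq_abs] at this
    simp [hz, this]
  · have : B (u - a • v) (u - a • v) < 0 :=
      neg_of_orthogonal_of_pos B hsymm hW (fun x hx hx0 => by linarith [hneg x hx hx0])
        (by rw [hvv]; positivity) (by simp [hvu, hvv]; ring) hz
    have := div_neg_of_neg_of_pos this hpos
    nlinarith [sq_nonneg a]

/-- the Bogoslovsky-type Lagrangian `L = L0^(1+b)/β^(2b)` with
`b ∈ (-1,0)` is again Lorentz-Finsler on `A`. -/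
theorem stmt_19 [FiniteDimensional ℝ V] (hn : 2 ≤ finrank ℝ V)
    (A : Set V) (hNe : A.Nonempty) (hop : IsOpen A) (hconic : Conic A)
    (h0 : (0 : V) ∉ A)
    (L0 : V → ℝ) (hpos : ∀ v ∈ A, 0 < L0 v)
    (hsmooth : ContDiffOn ℝ (⊤ : ℕ∞) L0 A) (hhom : PosHom2 L0 A)
    (hLor : ∀ v ∈ A, IsLorentzForm (fundTensor L0 v))
    (β : V →ₗ[ℝ] ℝ) (hβ : ∀ v ∈ A, 0 < β v)
    (b : ℝ) (hb1 : -1 < b) (hb0 : b < 0)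
    (L : V → ℝ) (hLdef : ∀ v, L v = L0 v ^ (1 + b) / (β v) ^ (2 * b)) :
    ContDiffOn ℝ (⊤ : ℕ∞) L A ∧ PosHom2 L A ∧
    ∀ v ∈ A, IsLorentzForm (fundTensor L v) := by
  set β' : V →L[ℝ] ℝ := LinearMap.toContinuousLinearMap β
  have hLpos : ∀ v ∈ A, 0 < L v := fun v hv => by
    rw [hLdef]
    exact div_pos (rpow_pos_of_pos (hpos v hv) _) (rpow_pos_of_pos (hβ v hv) _)
  have hLs : ContDiffOn ℝ (⊤ : ℕ∞) L A := by
    have : L = fun v => L0 v ^ (1 + b) / (β' v) ^ (2 * b) := funext hLdef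
    rw [this]
    exact (hsmooth.rpow_const_of_ne fun v hv => (hpos v hv).ne').div
      (β'.contDiff.contDiffOn.rpow_const_of_ne fun v hv => (hβ v hv).ne')
      fun v hv => (rpow_pos_of_pos (hβ v hv) _).ne'
  have hLh : PosHom2 L A := fun v hv c hc => by
    rw [hLdef, hLdef, hhom v hv c hc, map_smul, smul_eq_mul,
      mul_rpow (by positivity) (hpos v hv).le, mul_rpow hc.le (hβ v hv).le, ← rpow_natCast,
      ← rpow_mul hc.le, mul_div_mul_comm, ← rpow_sub hc]
    congr 2
    push_cast
    ring
  refine ⟨hLs, hLh, fun v hv => ?_⟩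
  have h2 : (2 : WithTop ℕ∞) ≤ ((⊤ : ℕ∞) : WithTop ℕ∞) := 
    WithTop.coe_le_coe.2 (le_top : (2 : ℕ∞) ≤ ⊤)
  have hs2 := hsmooth.of_le h2
  have hL2 := hLs.of_le h2
  have hat0 : ContDiffAt ℝ 2 L0 v := hs2.contDiffAt (hop.mem_nhds hv)
  have hat : ContDiffAt ℝ 2 L v := hL2.contDiffAt (hop.mem_nhds hv)
  have hatβ : ContDiffAt ℝ 2 β' v := β'.contDiff.contDiffAt
  have hsymm : ∀ x y, fderiv ℝ (fderiv ℝ L) v x y = fderiv ℝ (fderiv ℝ L) v y x :=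
    fun x y => (hat.isSymmSndFDerivAt (by simp)).eq x y
  have hlog : fderiv ℝ (fderiv ℝ fun x => Real.log (L x)) v =
      (1 + b) • fderiv ℝ (fderiv ℝ fun x => Real.log (L0 x)) v -
        (2 * b) • fderiv ℝ (fderiv ℝ fun x => Real.log (β' x)) v := by
    have hc0 := hat0.log (hpos v hv).ne'
    have hcβ := hatβ.log (hβ v hv).ne'
    have e0 : (fun x => Real.log (L x)) =ᶠ[nhds v]
        fun x => (1 + b) * Real.log (L0 x) - (2 * b) * Real.log (β' x) := by
      filter_upwards [hop.mem_nhds hv] with x hx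
      rw [hLdef, Real.log_div (rpow_pos_of_pos (hpos x hx) _).ne'
        (rpow_pos_of_pos (hβ x hx) _).ne', Real.log_rpow (hpos x hx), Real.log_rpow (hβ x hx)]
      rfl
    have e1 : fderiv ℝ (fun x => (1 + b) * Real.log (L0 x) - (2 * b) * Real.log (β' x))
        =ᶠ[nhds v] fun x => (1 + b) • fderiv ℝ (fun x => Real.log (L0 x)) x -
          (2 * b) • fderiv ℝ (fun x => Real.log (β' x)) x := by
      filter_upwards [hc0.eventually (by norm_num), hcβ.eventually (by norm_num)] with x hx hxβ
      exact (((hx.differentiableAt (by norm_num)).hasFDerivAt.const_mul _).sub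
        ((hxβ.differentiableAt (by norm_num)).hasFDerivAt.const_mul _)).fderiv
    have e2 : HasFDerivAt (fun x => (1 + b) • fderiv ℝ (fun x => Real.log (L0 x)) x -
        (2 * b) • fderiv ℝ (fun x => Real.log (β' x)) x) _ v :=
      (hc0.differentiableAt_fderiv_of_two_le.hasFDerivAt.const_smul (1 + b)).sub
        (hcβ.differentiableAt_fderiv_of_two_le.hasFDerivAt.const_smul (2 * b))
    rw [e0.fderiv.fderiv_eq, e1.fderiv_eq, e2.fderiv]
  have hEuler := hLh.fderiv_fderiv_apply_self hop hL2 hv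
  refine isLorentzForm_of_neg_orthogonal ((1 / 2 : ℝ) • fderiv ℝ (fderiv ℝ L) v)
    (fun u w => by simp [hsymm u w]) (v := v) ?_ fun h hh hne => ?_
  · have := hLh.fderiv_apply_self hv (hat.differentiableAt (by norm_num))
    have := hLpos v hv
    simp only [smul_apply, smul_eq_mul]
    rw [hEuler]
    linarith
  · have hdL : fderiv ℝ L v h = 0 := by
      rw [← hEuler, hsymm]
      simpa using hh
    have hneg := fderiv_fderiv_log_neg hop hs2 hhom hv (hpos v hv) (hLor v hv) hne
    have hβneg : fderiv ℝ (fderiv ℝ fun x => Real.log (β' x)) v h h ≤ 0 := by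
      rw [fderiv_fderiv_log hatβ (hβ v hv)]
      have : fderiv ℝ β' = fun _ => β' := funext fun x => β'.fderiv
      rw [this]
      simp only [fderiv_fun_const, Pi.zero_apply, zero_apply, zero_div,
        zero_sub, Left.neg_nonpos_iff]
      exact div_nonneg (mul_self_nonneg _) (sq_nonneg _)
    have hl := fderiv_fderiv_log hat (hLpos v hv) h h
    rw [hlog, hdL] at hl
    simp only [sub_apply, smul_apply, smul_eq_mul,
      zero_mul, zero_div, sub_zero] at hl
    have hlt : fderiv ℝ (fderiv ℝ L) v h h / L v < 0 := by
      rw [← hl]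
      nlinarith [mul_pos (by linarith : 0 < 1 + b) (neg_pos.2 hneg),
        mul_nonneg (by linarith : 0 ≤ -b) (neg_nonneg.2 hβneg)]
    have := neg_of_div_neg_left hlt (hLpos v hv).le
    simp only [smul_apply, smul_eq_mul]
    linarith
end
end
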